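/- arXiv:1907.11142 — 6 statements merged into one kernel-verified Lean document; each statement's English description precedes it below -/
import Mathlib

section
/- Let A be a real matrix with row index set I of size N and column index set J of size P ≥ 1. For 2 ≤ n ≤ N let H̄_n denote the average of the H-scores H(S,J) over all C(N,n) subsets S of I with |S| = n. Then for every n with 2 ≤ n ≤ N − 1 one has H̄_{n+1} = H̄_n · n²/(n² − 1). -/
open Finset

/-- The H-score (mean squared residue) of the submatrix of `a` determined by
row subset `S` and column subset `T`. -/
noncomputable def Hscore {I J : Type*} (a : I → J → ℝ) (S : Finset I) (T : Finset J) : ℝ :=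
  (1 / ((S.card : ℝ) * (T.card : ℝ))) * ∑ i ∈ S, ∑ j ∈ T,
    (a i j - (1 / (T.card : ℝ)) * ∑ k ∈ T, a i k
           - (1 / (S.card : ℝ)) * ∑ s ∈ S, a s j
           + (1 / ((S.card : ℝ) * (T.card : ℝ))) * ∑ s ∈ S, ∑ k ∈ T, a s k) ^ 2

/-- The average H-score of all submatrices with `n` rows (and all `P` columns). -/
noncomputable def HbarRow (N P : ℕ) (a : Fin N → Fin P → ℝ) (n : ℕ) : ℝ :=
  ((N.choose n : ℝ))⁻¹ *
    ∑ S ∈ Finset.powersetCard n (Finset.univ : Finset (Fin N)),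
      Hscore a S Finset.univ

lemma hrs_count (N n : ℕ) (i k : Fin N) (hik : i ≠ k) (hn : 2 ≤ n) :
    ((powersetCard n (univ : Finset (Fin N))).filter (fun S => i ∈ S ∧ k ∈ S)).card
      = (N - 2).choose (n - 2) := by
  have h2 : ({i, k} : Finset (Fin N)).card = 2 := card_pair hik
  have h3 : (univ \ {i, k} : Finset (Fin N)).card = N - 2 := by
    rw [card_sdiff_of_subset (subset_univ _), h2]; simp
  rw [← h3, ← card_powersetCard]
  refine card_bij' (fun S _ => S \ {i, k}) (fun S _ => S ∪ {i, k}) ?_ ?_ ?_ ?_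
  · intro S hS
    simp only [mem_filter, mem_powersetCard] at hS ⊢
    refine ⟨sdiff_subset_sdiff (subset_univ _) subset_rfl, ?_⟩
    rw [card_sdiff_of_subset (by intro x; simp; rintro (rfl | rfl); exacts [hS.2.1, hS.2.2]), h2,
      hS.1.2]
  · intro S hS
    simp only [mem_filter, mem_powersetCard] at hS ⊢
    refine ⟨⟨subset_univ _, ?_⟩, by simp, by simp⟩
    rw [card_union_of_disjoint, h2, hS.2]
    · omega
    · exact disjoint_of_subset_left hS.1 sdiff_disjoint
  · intro S hS
    simp only [mem_filter, mem_powersetCard] at hS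
    exact sdiff_union_of_subset (by intro x; simp; rintro (rfl | rfl); exacts [hS.2.1, hS.2.2])
  · intro S hS
    simp only [mem_powersetCard] at hS
    exact union_sdiff_cancel_right (disjoint_of_subset_left hS.1 sdiff_disjoint)

lemma hrs_var {I : Type*} (S : Finset I) (hS : (S.card : ℝ) ≠ 0) (b : I → ℝ) :
    ∑ i ∈ S, (b i - (1 / (S.card : ℝ)) * ∑ s ∈ S, b s) ^ 2
      = (1 / (2 * (S.card : ℝ))) * ∑ i ∈ S, ∑ k ∈ S, (b i - b k) ^ 2 := by
  simp only [sub_sq, sum_add_distrib, sum_sub_distrib, ← mul_sum, ← sum_mul, sum_const,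
    nsmul_eq_mul]
  field_simp
  ring

/-- Centred rows. -/
noncomputable def hrsB {I : Type*} {P : ℕ} (a : I → Fin P → ℝ) (i : I) (j : Fin P) : ℝ :=
  a i j - (1 / (P : ℝ)) * ∑ k, a i k

lemma hrs_score {I : Type*} {P : ℕ} (a : I → Fin P → ℝ) (S : Finset I)
    (hS : (S.card : ℝ) ≠ 0) :
    Hscore a S univ = (1 / (2 * (S.card : ℝ) ^ 2 * P)) *
      ∑ i ∈ S, ∑ k ∈ S, ∑ j, (hrsB a i j - hrsB a k j) ^ 2 := by
  have h1 : ∀ i j, (a i j - (1 / (P : ℝ)) * ∑ k, a i k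
           - (1 / (S.card : ℝ)) * ∑ s ∈ S, a s j
           + (1 / ((S.card : ℝ) * (P : ℝ))) * ∑ s ∈ S, ∑ k, a s k)
      = hrsB a i j - (1 / (S.card : ℝ)) * ∑ s ∈ S, hrsB a s j := by
    intro i j
    simp only [hrsB, sum_sub_distrib, ← mul_sum]
    rw [one_div_mul_eq_div, one_div_mul_eq_div, one_div_mul_eq_div, one_div_mul_eq_div,
      one_div_mul_eq_div, div_eq_mul_inv _ ((S.card : ℝ) * P), mul_inv]
    ring
  unfold Hscore
  simp only [card_univ, Fintype.card_fin, h1]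
  rw [sum_comm]
  simp only [hrs_var S hS (fun i => hrsB a i _)]
  have h2 : ∑ i ∈ S, ∑ k ∈ S, ∑ j, (hrsB a i j - hrsB a k j) ^ 2
      = ∑ j, ∑ i ∈ S, ∑ k ∈ S, (hrsB a i j - hrsB a k j) ^ 2 := by
    rw [sum_comm (s := univ)]
    refine sum_congr rfl fun i _ => ?_
    rw [sum_comm]
  rw [h2, ← mul_sum, ← mul_assoc]
  congr 1
  simp only [one_div, mul_inv, ← inv_pow]
  ring

lemma hrs_swap (N n : ℕ) (hn : 2 ≤ n) (d : Fin N → Fin N → ℝ) (hd : ∀ i, d i i = 0) :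
    ∑ S ∈ powersetCard n (univ : Finset (Fin N)), ∑ i ∈ S, ∑ k ∈ S, d i k
      = ((N - 2).choose (n - 2) : ℝ) * ∑ i, ∑ k, d i k := by
  have h : ∀ S : Finset (Fin N), ∑ i ∈ S, ∑ k ∈ S, d i k
      = ∑ i, ∑ k, if i ∈ S ∧ k ∈ S then d i k else 0 := by
    intro S
    simp only [ite_and, sum_ite_irrel, sum_const_zero, sum_ite_mem, univ_inter]
  rw [sum_congr rfl fun S _ => h S]
  rw [sum_comm, mul_sum]
  refine sum_congr rfl fun i _ => ?_
  rw [sum_comm, mul_sum]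
  refine sum_congr rfl fun k _ => ?_
  rw [← sum_filter, sum_const, nsmul_eq_mul]
  by_cases hik : i = k
  · subst hik; simp [hd]
  · rw [hrs_count N n i k hik hn]

lemma hrs_bar (M P m : ℕ) (hm : m ≤ M) (a : Fin (M + 2) → Fin P → ℝ) :
    HbarRow (M + 2) P a (m + 2) = ((m : ℝ) + 1) / (m + 2) *
      ((∑ i, ∑ k, ∑ j, (hrsB a i j - hrsB a k j) ^ 2) / (2 * P * ((M + 2) * (M + 1)))) := by
  unfold HbarRow
  have h : ∀ S ∈ powersetCard (m + 2) (univ : Finset (Fin (M + 2))),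
      Hscore a S univ = (1 / (2 * ((m : ℝ) + 2) ^ 2 * P)) *
      ∑ i ∈ S, ∑ k ∈ S, ∑ j, (hrsB a i j - hrsB a k j) ^ 2 := by
    intro S hS
    have hc : (S.card : ℝ) = m + 2 := by rw [(mem_powersetCard.1 hS).2]; push_cast; ring
    rw [hrs_score a S (by rw [hc]; positivity), hc]
  rw [sum_congr rfl h, ← mul_sum, hrs_swap _ _ (by omega) _ (by simp)]
  have e1 : ((M : ℝ) + 1) * (M.choose m) = ((M + 1).choose (m + 1)) * (m + 1) := by
    exact_mod_cast Nat.add_one_mul_choose_eq M m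
  have e2 : ((M : ℝ) + 2) * ((M + 1).choose (m + 1)) = ((M + 2).choose (m + 2)) * (m + 2) := by
    exact_mod_cast Nat.add_one_mul_choose_eq (M + 1) (m + 1)
  have hpos : ((M + 2).choose (m + 2) : ℝ) ≠ 0 := by
    exact_mod_cast (Nat.choose_pos (by omega)).ne'
  have e3 : (M.choose m : ℝ) =
      ((M + 2).choose (m + 2)) * (m + 2) * (m + 1) / ((M + 2) * (M + 1)) := by
    rw [eq_div_iff (by positivity), ← e2]; linear_combination (M + 2 : ℝ) * e1
  simp only [Nat.add_sub_cancel]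
  rw [e3]
  generalize (∑ i, ∑ k, ∑ j, (hrsB a i j - hrsB a k j) ^ 2) = D
  by_cases hP : (P : ℝ) = 0
  · simp [hP]
  have : (m : ℝ) + 2 ≠ 0 := by positivity
  have : (M : ℝ) + 2 ≠ 0 := by positivity
  have : (M : ℝ) + 1 ≠ 0 := by positivity
  field_simp

/-- Theorem 1 (rows): the average H-score over all `(n+1)`-row submatrices equals
the average H-score over all `n`-row submatrices times `n²/(n²-1)`. -/
theorem hbar_row_succ (N P : ℕ) (hP : 1 ≤ P) (a : Fin N → Fin P → ℝ)
    (n : ℕ) (hn : 2 ≤ n) (hnN : n + 1 ≤ N) :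
    HbarRow N P a (n + 1) = HbarRow N P a n * ((n : ℝ) ^ 2 / ((n : ℝ) ^ 2 - 1)) := by
  obtain ⟨m, rfl⟩ := Nat.exists_eq_add_of_le' hn
  obtain ⟨M, rfl⟩ : ∃ M, N = M + 2 := ⟨N - 2, by omega⟩
  rw [show m + 2 + 1 = (m + 1) + 2 by ring, hrs_bar M P (m + 1) (by omega),
    hrs_bar M P m (by omega)]
  generalize (∑ i, ∑ k, ∑ j, (hrsB a i j - hrsB a k j) ^ 2) / _ = D
  push_cast
  have h0 : ((m : ℝ) + 2) ^ 2 - 1 = (m + 1) * (m + 3) := by ring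
  rw [h0]
  have : (m : ℝ) + 2 ≠ 0 := by positivity
  have : (m : ℝ) + 1 ≠ 0 := by positivity
  have : (m : ℝ) + 3 ≠ 0 := by positivity
  rw [show (m : ℝ) + 1 + 2 = m + 3 by ring]
  field_simp
  ring
end

section
/- Let A be a real matrix with row index set I of size N ≥ 1 and column index set J of size P. For 2 ≤ p ≤ P let H̄_p denote the average of the H-scores H(I,T) over all C(P,p) subsets T of J with |T| = p. Then for every p with 2 ≤ p ≤ P − 1 one has H̄_{p+1} = H̄_p · p²/(p² − 1). -/
open Finset

/-- The average H-score of all submatrices with `p` columns (and all `N` rows). -/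
noncomputable def HbarCol (N P : ℕ) (a : Fin N → Fin P → ℝ) (p : ℕ) : ℝ :=
  ((P.choose p : ℝ))⁻¹ *
    ∑ T ∈ Finset.powersetCard p (Finset.univ : Finset (Fin P)),
      Hscore a Finset.univ T

/-- Sum of squared deviations as a sum over pairs. -/
lemma sq_dev_pairs {J : Type*} (T : Finset J) (x : J → ℝ) (hT : (T.card : ℝ) ≠ 0) :
    ∑ j ∈ T, (x j - (1 / (T.card : ℝ)) * ∑ k ∈ T, x k) ^ 2
      = (1 / (2 * (T.card : ℝ))) * ∑ j ∈ T, ∑ k ∈ T, (x j - x k) ^ 2 := by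
  have h1 : ∀ c : ℝ, ∑ j ∈ T, (x j - c) ^ 2
      = ∑ j ∈ T, x j ^ 2 - 2 * c * ∑ j ∈ T, x j + T.card * c ^ 2 := by
    intro c
    simp only [sub_sq, Finset.sum_add_distrib, Finset.sum_sub_distrib, Finset.mul_sum,
      Finset.sum_const, nsmul_eq_mul]
    congr 2
    exact Finset.sum_congr rfl fun j _ => by ring
  have h2 : ∑ j ∈ T, ∑ k ∈ T, (x j - x k) ^ 2
      = 2 * (T.card : ℝ) * ∑ j ∈ T, x j ^ 2 - 2 * (∑ j ∈ T, x j) ^ 2 := by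
    rw [Finset.sum_comm]
    simp only [h1, Finset.sum_add_distrib, Finset.sum_sub_distrib,
      Finset.sum_const, nsmul_eq_mul, ← Finset.mul_sum, ← Finset.sum_mul]
    ring
  rw [h1, h2]
  field_simp
  ring

/-- Squared distance of row-centred columns. -/
noncomputable def colDist {N P : ℕ} (a : Fin N → Fin P → ℝ) (j k : Fin P) : ℝ :=
  ∑ i, ((a i j - (1 / (N : ℝ)) * ∑ s, a s j) - (a i k - (1 / (N : ℝ)) * ∑ s, a s k)) ^ 2

lemma Hscore_eq {N P : ℕ} (a : Fin N → Fin P → ℝ) (T : Finset (Fin P))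
    (hT : (T.card : ℝ) ≠ 0) :
    Hscore a Finset.univ T
      = (1 / (2 * (N : ℝ) * (T.card : ℝ) ^ 2)) * ∑ j ∈ T, ∑ k ∈ T, colDist a j k := by
  have h : ∀ i, ∑ j ∈ T, (a i j - (1 / (T.card : ℝ)) * ∑ k ∈ T, a i k
           - (1 / (N : ℝ)) * ∑ s, a s j
           + (1 / ((N : ℝ) * (T.card : ℝ))) * ∑ s, ∑ k ∈ T, a s k) ^ 2
      = (1 / (2 * (T.card : ℝ))) * ∑ j ∈ T, ∑ k ∈ T,
        ((a i j - (1 / (N : ℝ)) * ∑ s, a s j) - (a i k - (1 / (N : ℝ)) * ∑ s, a s k)) ^ 2 := by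
    intro i
    rw [← sq_dev_pairs T (fun j => a i j - (1 / (N : ℝ)) * ∑ s, a s j) hT]
    refine Finset.sum_congr rfl fun j _ => ?_
    congr 1
    rw [Finset.sum_sub_distrib, ← Finset.mul_sum, Finset.sum_comm, one_div_mul_eq_div,
      one_div_mul_eq_div, one_div_mul_eq_div, one_div_mul_eq_div, one_div_mul_eq_div,
      sub_div, div_div]
    ring
  unfold Hscore colDist
  simp only [Finset.card_univ, Fintype.card_fin]
  rw [Finset.sum_congr rfl fun i _ => h i, ← Finset.mul_sum, Finset.sum_comm,
    Finset.sum_congr rfl fun j _ => Finset.sum_comm, ← mul_assoc]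
  congr 1
  rw [one_div_mul_one_div]
  congr 1
  ring

lemma sum_pairs {P : ℕ} (D : Fin P → Fin P → ℝ) (hD : ∀ j, D j j = 0) (p : ℕ) (hp : 2 ≤ p) :
    ∑ T ∈ Finset.powersetCard p (Finset.univ : Finset (Fin P)), ∑ j ∈ T, ∑ k ∈ T, D j k
      = ((P - 2).choose (p - 2) : ℝ) * ∑ j, ∑ k, D j k := by
  have h1 : ∀ T : Finset (Fin P), ∑ j ∈ T, ∑ k ∈ T, D j k
      = ∑ j, ∑ k, if ({j, k} : Finset (Fin P)) ⊆ T then D j k else 0 := by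
    intro T
    simp only [Finset.insert_subset_iff, Finset.singleton_subset_iff, ite_and]
    have : ∀ f : Fin P → ℝ, ∑ j, (if j ∈ T then f j else 0) = ∑ j ∈ T, f j := by intro f; simp
    rw [← this]
    refine Finset.sum_congr rfl fun j _ => ?_
    by_cases hj : j ∈ T <;> simp [hj]
  simp only [h1]
  rw [Finset.sum_comm, Finset.mul_sum]
  refine Finset.sum_congr rfl fun j _ => ?_
  rw [Finset.sum_comm, Finset.mul_sum]
  refine Finset.sum_congr rfl fun k _ => ?_
  by_cases hjk : j = k
  · subst hjk; simp [hD]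
  have hc : ({j, k} : Finset (Fin P)).card = 2 := Finset.card_pair hjk
  rw [← Finset.sum_filter, Finset.sum_const, nsmul_eq_mul]
  rw [Finset.card_filter_powersetCard_subset]
  all_goals simp [hc, hp]

lemma HbarCol_eq (N P : ℕ) (a : Fin N → Fin P → ℝ) (p : ℕ) (hp : 2 ≤ p) (hpP : p ≤ P) :
    HbarCol N P a p = ((p : ℝ) - 1) / p *
      ((1 / (2 * (N : ℝ) * (P * (P - 1)))) * ∑ j, ∑ k, colDist a j k) := by
  have hp0 : (p : ℝ) ≠ 0 := by positivity
  unfold HbarCol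
  have h : ∀ T ∈ Finset.powersetCard p (Finset.univ : Finset (Fin P)),
      Hscore a Finset.univ T
        = (1 / (2 * (N : ℝ) * (p : ℝ) ^ 2)) * ∑ j ∈ T, ∑ k ∈ T, colDist a j k := by
    intro T hT
    have hc := (Finset.mem_powersetCard.mp hT).2
    rw [Hscore_eq a T (by rw [hc]; exact hp0), hc]
  rw [Finset.sum_congr rfl h, ← Finset.mul_sum, sum_pairs _ (by simp [colDist]) p hp]
  obtain ⟨q, rfl⟩ : ∃ q, p = q + 2 := ⟨p - 2, by omega⟩
  obtain ⟨Q, rfl⟩ : ∃ Q, P = Q + 2 := ⟨P - 2, by omega⟩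
  have e1 := Nat.add_one_mul_choose_eq Q q
  have e2 := Nat.add_one_mul_choose_eq (Q + 1) (q + 1)
  have hne : ((Q + 2).choose (q + 2) : ℝ) ≠ 0 := by
    exact_mod_cast (Nat.choose_pos hpP).ne'
  have e3 : ((Q : ℝ) + 2) * (Q + 1) * Q.choose q = (Q + 2).choose (q + 2) * (q + 2) * (q + 1) := by
    have e1' : ((Q : ℝ) + 1) * Q.choose q = (Q + 1).choose (q + 1) * (q + 1) := by exact_mod_cast e1
    have e2' : ((Q : ℝ) + 2) * (Q + 1).choose (q + 1) = (Q + 2).choose (q + 2) * (q + 2) := by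
      exact_mod_cast e2
    linear_combination (Q + 2 : ℝ) * e1' + (q + 1 : ℝ) * e2'
  have hQ1 : (Q : ℝ) + 1 ≠ 0 := by positivity
  have hQ2 : (Q : ℝ) + 2 ≠ 0 := by positivity
  have hq2 : (q : ℝ) + 2 ≠ 0 := by positivity
  have e4 : (Q.choose q : ℝ)
      = (Q + 2).choose (q + 2) * (q + 2) * (q + 1) / ((Q + 2) * (Q + 1)) := by
    rw [eq_div_iff (mul_ne_zero hQ2 hQ1)]; linear_combination e3
  simp only [Nat.add_sub_cancel]
  rw [e4]
  push_cast
  generalize (∑ j, ∑ k, colDist a j k) = S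
  have r1 : (Q : ℝ) + 2 - 1 = Q + 1 := by ring
  have r2 : (q : ℝ) + 2 - 1 = q + 1 := by ring
  rw [r1, r2]
  by_cases hN : (N : ℝ) = 0
  · simp [hN]
  field_simp

/-- Theorem 1 (columns): the average H-score over all `(p+1)`-column submatrices equals
the average H-score over all `p`-column submatrices times `p²/(p²-1)`. -/
theorem hbar_col_succ (N P : ℕ) (hN : 1 ≤ N) (a : Fin N → Fin P → ℝ)
    (p : ℕ) (hp : 2 ≤ p) (hpP : p + 1 ≤ P) :
    HbarCol N P a (p + 1) = HbarCol N P a p * ((p : ℝ) ^ 2 / ((p : ℝ) ^ 2 - 1)) := by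
  rw [HbarCol_eq N P a (p + 1) (by omega) hpP, HbarCol_eq N P a p hp (by omega)]
  have h2 : (2 : ℝ) ≤ p := by exact_mod_cast hp
  have h0 : (p : ℝ) ≠ 0 := by positivity
  have h1 : (p : ℝ) - 1 ≠ 0 := by linarith
  have h3 : (p : ℝ) + 1 ≠ 0 := by positivity
  have h4 : (p : ℝ) ^ 2 - 1 = (p - 1) * (p + 1) := by ring
  rw [h4]
  generalize (1 / (2 * (N : ℝ) * (P * (P - 1)))) * ∑ j, ∑ k, colDist a j k = S
  push_cast
  field_simp
  ring
end

section
/- Let A be a real matrix with row index set I of size N and column index set J of size P ≥ 1, and for 2 ≤ n ≤ N let H̄_n denote the average of the H-scores H(S,J) over all subsets S ⊆ I with |S| = n. Then for all n ≥ 2 and m ≥ 0 with n + m ≤ N, one has H̄_{n+m} = H̄_n · ∏_{i=n}^{n+m−1} i²/(i² − 1). -/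
open Finset

lemma aux_var {I : Type*} (S : Finset I) (hS : (S.card : ℝ) ≠ 0) (x : I → ℝ) :
    ∑ i ∈ S, (x i - (1 / (S.card : ℝ)) * ∑ s ∈ S, x s) ^ 2
      = (1 / (2 * (S.card : ℝ))) * ∑ i ∈ S, ∑ k ∈ S, (x i - x k) ^ 2 := by
  have h1 : ∑ i ∈ S, ∑ k ∈ S, (x i - x k) ^ 2
      = 2 * (S.card : ℝ) * ∑ i ∈ S, x i ^ 2 - 2 * (∑ i ∈ S, x i) ^ 2 := by
    simp only [sub_sq, sum_add_distrib, sum_sub_distrib, sum_const, nsmul_eq_mul, ← mul_sum,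
      ← sum_mul]
    ring
  rw [h1]
  generalize hX : ∑ i ∈ S, x i = X
  simp only [sub_sq, sum_add_distrib, sum_sub_distrib, sum_const, nsmul_eq_mul, ← mul_sum,
      ← sum_mul, hX]
  field_simp
  ring

/-- squared distance of the row-centred rows -/
noncomputable def auxD {N P : ℕ} (a : Fin N → Fin P → ℝ) (i k : Fin N) : ℝ :=
  ∑ j, ((a i j - (1 / (P : ℝ)) * ∑ l, a i l) - (a k j - (1 / (P : ℝ)) * ∑ l, a k l)) ^ 2

lemma aux_H {N P : ℕ} (a : Fin N → Fin P → ℝ) (S : Finset (Fin N))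
    (hS : (S.card : ℝ) ≠ 0) :
    Hscore a S Finset.univ
      = (1 / (2 * (S.card : ℝ) ^ 2 * P)) * ∑ i ∈ S, ∑ k ∈ S, auxD a i k := by
  unfold Hscore auxD
  rw [sum_comm]
  simp only [Finset.card_univ, Fintype.card_fin]
  have h : ∀ j : Fin P, ∑ i ∈ S, (a i j - (1 / (P : ℝ)) * ∑ k, a i k
           - (1 / (S.card : ℝ)) * ∑ s ∈ S, a s j
           + (1 / ((S.card : ℝ) * (P : ℝ))) * ∑ s ∈ S, ∑ k, a s k) ^ 2
      = (1 / (2 * (S.card : ℝ))) * ∑ i ∈ S, ∑ k ∈ S,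
        ((a i j - (1 / (P : ℝ)) * ∑ l, a i l) - (a k j - (1 / (P : ℝ)) * ∑ l, a k l)) ^ 2 := by
    intro j
    rw [← aux_var S hS (fun i => a i j - (1 / (P : ℝ)) * ∑ l, a i l)]
    refine sum_congr rfl fun i _ => ?_
    congr 1
    rw [sum_sub_distrib, ← mul_sum, mul_sub, ← mul_assoc, one_div_mul_one_div]
    ring
  rw [sum_congr rfl fun j _ => h j, ← mul_sum, sum_comm, ← mul_assoc]
  congr 1
  · simp only [one_div, mul_inv]
    ring
  · exact sum_congr rfl fun i _ => sum_comm

lemma aux_count (M k : ℕ) (D : Fin (M + 2) → Fin (M + 2) → ℝ) (hD : ∀ i, D i i = 0)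
    (hk : k ≤ M) :
    ∑ S ∈ powersetCard (k + 2) (univ : Finset (Fin (M + 2))), ∑ i ∈ S, ∑ l ∈ S, D i l
      = (M.choose k : ℝ) * ∑ i, ∑ l, D i l := by
  have h1 : ∀ S : Finset (Fin (M + 2)), ∑ i ∈ S, ∑ l ∈ S, D i l
      = ∑ i, ∑ l, if {i, l} ⊆ S then D i l else 0 := by
    intro S
    simp only [insert_subset_iff, singleton_subset_iff, ite_and, sum_ite_irrel, sum_const_zero, sum_ite_mem, univ_inter]
  simp only [h1]
  rw [sum_comm, mul_sum]
  refine sum_congr rfl fun i _ => ?_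
  rw [sum_comm, mul_sum]
  refine sum_congr rfl fun l _ => ?_
  by_cases hil : i = l
  · subst hil; simp [hD]
  · rw [← sum_filter, sum_const, nsmul_eq_mul]
    have hc : ({i, l} : Finset (Fin (M + 2))).card = 2 := card_pair hil
    rw [card_filter_powersetCard_subset _ _ _ (subset_univ _)  (by omega)]
    simp [hc]

lemma aux_choose (M k : ℕ) :
    ((M + 2).choose (k + 2) : ℝ) * ((k + 2) * (k + 1)) = (M + 2) * (M + 1) * M.choose k := by
  have h1 := Nat.add_one_mul_choose_eq (M + 1) (k + 1)
  have h2 := Nat.add_one_mul_choose_eq M k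
  have h1' : ((M : ℝ) + 1 + 1) * ((M + 1).choose (k + 1)) = (M + 2).choose (k + 2) * (k + 1 + 1) := by
    exact_mod_cast h1
  have h2' : ((M : ℝ) + 1) * (M.choose k) = (M + 1).choose (k + 1) * (k + 1) := by
    exact_mod_cast h2
  linear_combination (-(k + 1 : ℝ)) * h1' - (M + 2 : ℝ) * h2'

lemma aux_bar (M P k : ℕ) (a : Fin (M + 2) → Fin P → ℝ) (hk : k ≤ M) :
    HbarRow (M + 2) P a (k + 2)
      = ((k + 1 : ℝ) / (k + 2)) *
        ((1 / (2 * P * ((M + 2) * (M + 1)))) * ∑ i, ∑ l, auxD a i l) := by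
  unfold HbarRow
  have h : ∀ S ∈ powersetCard (k + 2) (univ : Finset (Fin (M + 2))), Hscore a S univ
      = (1 / (2 * (k + 2 : ℝ) ^ 2 * P)) * ∑ i ∈ S, ∑ l ∈ S, auxD a i l := by
    intro S hS
    have hc := (mem_powersetCard.1 hS).2
    have hc' : (S.card : ℝ) = k + 2 := by rw [hc]; push_cast; ring
    rw [aux_H a S (by rw [hc']; positivity), hc']
  rw [sum_congr rfl h, ← mul_sum, aux_count M k _ (by intro i; simp [auxD]) hk]
  have hch := aux_choose M k
  have hpos : ((M + 2).choose (k + 2) : ℝ) ≠ 0 := by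
    exact_mod_cast (Nat.choose_pos (by omega)).ne'
  have e : (M.choose k : ℝ)
      = ((M + 2).choose (k + 2) : ℝ) * ((k + 2) * (k + 1)) / ((M + 2) * (M + 1)) := by
    rw [hch]; field_simp
  rw [e]
  generalize ((M + 2).choose (k + 2) : ℝ) = c at *
  generalize ∑ i, ∑ l, auxD a i l = s
  rcases eq_or_ne (P : ℝ) 0 with hP | hP
  · simp [hP]
  · field_simp

/-- Equation (3): iterating Theorem 1,
`H̄_{n+m} = H̄_n · ∏_{i=n}^{n+m-1} i²/(i²-1)`. -/
theorem hbar_row_add (N P : ℕ) (hP : 1 ≤ P) (a : Fin N → Fin P → ℝ)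
    (n m : ℕ) (hn : 2 ≤ n) (hnm : n + m ≤ N) :
    HbarRow N P a (n + m) =
      HbarRow N P a n * ∏ i ∈ Finset.Ico n (n + m), ((i : ℝ) ^ 2 / ((i : ℝ) ^ 2 - 1)) := by
  obtain ⟨k, rfl⟩ : ∃ k, n = k + 2 := ⟨n - 2, by omega⟩
  obtain ⟨M, rfl⟩ : ∃ M, N = M + 2 := ⟨N - 2, by omega⟩
  induction m with
  | zero => simp
  | succ m ih =>
    rw [← add_assoc, prod_Ico_succ_top (by omega), ← mul_assoc, ← ih (by omega)]
    rw [show k + 2 + m + 1 = (k + m + 1) + 2 by ring, show k + 2 + m = (k + m) + 2 by ring,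
      aux_bar _ _ _ _ (by omega), aux_bar _ _ _ _ (by omega)]
    generalize ((1 / (2 * (P : ℝ) * ((M + 2) * (M + 1)))) * ∑ i, ∑ l, auxD a i l) = s
    push_cast
    generalize hx : (k : ℝ) + m = x
    have hx0 : 0 ≤ x := by rw [← hx]; positivity
    have : (x + 2) ^ 2 - 1 = (x + 1) * (x + 3) := by ring
    rw [this]
    have h3 : x + 1 + 2 = x + 3 := by ring
    rw [h3]
    field_simp
    ring
end

section
/- Let a = (a_{ij}) be a real matrix indexed by finite nonempty sets I and J. Then H(I,J) ≥ 0, and H(I,J) = 0 if and only if there exist a real number μ and real families (α_i)_{i∈I}, (β_j)_{j∈J} such that a_{ij} = μ + α_i + β_j for all i ∈ I, j ∈ J. -/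
open Finset

/-- The H-score is nonnegative, and it vanishes iff the matrix is perfectly
described by the additive model `a_{ij} = μ + α_i + β_j`. -/
theorem hscore_nonneg_and_eq_zero_iff_additive
    {I J : Type*} [Fintype I] [Fintype J] [Nonempty I] [Nonempty J]
    (a : I → J → ℝ) :
    0 ≤ Hscore a Finset.univ Finset.univ ∧
      (Hscore a Finset.univ Finset.univ = 0 ↔
        ∃ (μ : ℝ) (α : I → ℝ) (β : J → ℝ), ∀ i j, a i j = μ + α i + β j) := by
  have hI : (0 : ℝ) < ((Finset.univ : Finset I).card : ℝ) := by
    exact_mod_cast Finset.card_pos.mpr Finset.univ_nonempty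
  have hJ : (0 : ℝ) < ((Finset.univ : Finset J).card : ℝ) := by
    exact_mod_cast Finset.card_pos.mpr Finset.univ_nonempty
  refine ⟨?_, ?_, ?_⟩
  · unfold Hscore
    positivity
  · intro h
    unfold Hscore at h
    have h1 := (mul_eq_zero.mp h).resolve_left (by positivity)
    rw [Finset.sum_eq_zero_iff_of_nonneg (fun i _ => by positivity)] at h1
    refine ⟨-((1 / (((Finset.univ : Finset I).card : ℝ) * ((Finset.univ : Finset J).card : ℝ)))
        * ∑ s, ∑ k, a s k),
      fun i => (1 / ((Finset.univ : Finset J).card : ℝ)) * ∑ k, a i k,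
      fun j => (1 / ((Finset.univ : Finset I).card : ℝ)) * ∑ s, a s j, fun i j => ?_⟩
    have h2 := h1 i (Finset.mem_univ i)
    rw [Finset.sum_eq_zero_iff_of_nonneg (fun i _ => by positivity)] at h2
    have h3 := pow_eq_zero_iff (two_ne_zero) |>.mp (h2 j (Finset.mem_univ j))
    linarith
  · rintro ⟨μ, α, β, h⟩
    unfold Hscore
    apply mul_eq_zero_of_right
    refine Finset.sum_eq_zero fun i _ => Finset.sum_eq_zero fun j _ => ?_
    rw [pow_eq_zero_iff two_ne_zero]
    simp only [h, Finset.sum_add_distrib, Finset.sum_const, nsmul_eq_mul, ← Finset.mul_sum]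
    field_simp
    ring
end

section
/- Let a = (a_{ij}) be a real matrix indexed by I = {1,…,N} and J = {1,…,P} with N, P ≥ 1. Then N·P·H(I,J) is the quadratic form N·P·H(I,J) = h_sq · Σ_{i,j} a_{ij}² + h_row · Σ_{i} Σ_{j1 ≠ j2} a_{i j1} a_{i j2} + h_col · Σ_{j} Σ_{i1 ≠ i2} a_{i1 j} a_{i2 j} + h_mix · Σ_{i1 ≠ i2} Σ_{j1 ≠ j2} a_{i1 j1} a_{i2 j2}, where (with the sums over ordered pairs counted once per unordered double product, i.e. the double-product sums below are over unordered pairs each counted with its stated coefficient): h_sq = [(NP − N − P + 1)² + (P−1)(N−1)² + (P−1)²(N−1) + (P−1)(N−1)]/(N²P²), h_row = [4(NP−N−P+1)(1−N) + 2(P−2)(N−1)² + 4(1−P)(N−1) + 2(P−2)(N−1)]/(N²P²), h_col = [4(NP−N−P+1)(1−P) + 2(N−2)(P−1)² + 4(1−N)(P−1) + 2(N−2)(P−1)]/(N²P²), h_mix = [4(NP−N−P+1) + 4(1−P)(1−N) + 4(P−2)(1−N) + 4(1−P)(N−2) + 2(P−2)(N−2)]/(N²P²). -/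
open Finset

lemma two_mul_sum_lt {n : ℕ} (f : Fin n → ℝ) :
    ∑ i : Fin n, ∑ j ∈ Finset.filter (fun j => i < j) Finset.univ, f i * f j
      = ((∑ i, f i) ^ 2 - ∑ i, f i ^ 2) / 2 := by
  have h1 : (∑ i, f i) ^ 2 = ∑ i : Fin n, ∑ j : Fin n, ((if i < j then f i * f j else 0)
      + (if j < i then f j * f i else 0) + (if i = j then f i * f j else 0)) := by
    rw [sq, Finset.sum_mul_sum]
    refine Finset.sum_congr rfl fun i _ => Finset.sum_congr rfl fun j _ => ?_
    rcases lt_trichotomy i j with h | h | h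
    · simp [h, h.not_gt, h.ne]
    · subst h; simp
    · simp [h, h.not_gt, h.ne', mul_comm]
  have h2 : ∑ i : Fin n, ∑ j : Fin n, (if j < i then f j * f i else 0)
      = ∑ i : Fin n, ∑ j : Fin n, (if i < j then f i * f j else 0) := Finset.sum_comm
  simp only [Finset.sum_add_distrib] at h1
  rw [h2] at h1
  simp only [Finset.sum_filter]
  simp only [Finset.sum_ite_eq, Finset.mem_univ, if_true] at h1
  have h3 : ∑ i, f i ^ 2 = ∑ i, f i * f i := by simp only [sq]
  rw [h1, h3]; ring

lemma sum_residue {N P : ℕ} (a : Fin N → Fin P → ℝ) (u v w : ℝ) :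
    ∑ i : Fin N, ∑ j : Fin P,
      (a i j - u * ∑ k, a i k - v * ∑ s, a s j + w * ∑ s, ∑ k, a s k) ^ 2
    = (∑ i, ∑ j, a i j ^ 2) + (P * u ^ 2 - 2 * u) * (∑ i, (∑ j, a i j) ^ 2)
      + (N * v ^ 2 - 2 * v) * (∑ j, (∑ i, a i j) ^ 2)
      + (2 * w + 2 * u * v - 2 * P * u * w - 2 * N * v * w + N * P * w ^ 2)
        * (∑ i, ∑ j, a i j) ^ 2 := by
  set T := ∑ i, ∑ j, a i j with hT
  have e : ∀ i j, (a i j - u * ∑ k, a i k - v * ∑ s, a s j + w * T) ^ 2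
      = a i j ^ 2 + u ^ 2 * (∑ k, a i k) ^ 2 + v ^ 2 * (∑ s, a s j) ^ 2 + w ^ 2 * T ^ 2
        - 2 * u * ((∑ k, a i k) * a i j) - 2 * v * (a i j * (∑ s, a s j)) + 2 * w * T * a i j
        + 2 * u * v * ((∑ k, a i k) * (∑ s, a s j)) - 2 * u * w * T * (∑ k, a i k)
        - 2 * v * w * T * (∑ s, a s j) := by
    intro i j; ring
  have hT' : ∑ j, ∑ i, a i j = T := Finset.sum_comm
  have hc : ∑ i, ∑ j, a i j * (∑ s, a s j) = ∑ j, (∑ i, a i j) ^ 2 := by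
    rw [Finset.sum_comm]
    refine Finset.sum_congr rfl fun j _ => ?_
    rw [← Finset.sum_mul, sq]
  have hrc : ∑ i, ∑ j, (∑ k, a i k) * (∑ s, a s j) = T ^ 2 := by
    rw [← Finset.sum_mul_sum, hT', sq]
  simp only [e, Finset.sum_add_distrib, Finset.sum_sub_distrib, ← Finset.mul_sum] at hc hrc ⊢
  rw [hc, hrc, hT', ← hT]
  simp only [Finset.sum_const, Finset.card_univ, Fintype.card_fin, nsmul_eq_mul,
    ← Finset.mul_sum, ← sq, hT', ← hT]
  ring

lemma sum_mix {N P : ℕ} (a : Fin N → Fin P → ℝ) :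
    ∑ i₁ : Fin N, ∑ i₂ ∈ Finset.filter (fun i₂ => i₁ < i₂) Finset.univ,
      ∑ j₁ : Fin P, ∑ j₂ ∈ Finset.filter (fun j₂ => j₂ ≠ j₁) Finset.univ, a i₁ j₁ * a i₂ j₂
    = ((∑ i, ∑ j, a i j) ^ 2 - ∑ i, (∑ j, a i j) ^ 2) / 2
      - ∑ j : Fin P, ∑ i₁ : Fin N, ∑ i₂ ∈ Finset.filter (fun i₂ => i₁ < i₂) Finset.univ,
            a i₁ j * a i₂ j := by
  rw [← two_mul_sum_lt (fun i => ∑ j, a i j), Finset.sum_comm (s := (Finset.univ : Finset (Fin P))),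
    ← Finset.sum_sub_distrib]
  refine Finset.sum_congr rfl fun i _ => ?_
  rw [Finset.sum_comm (s := (Finset.univ : Finset (Fin P))), ← Finset.sum_sub_distrib]
  refine Finset.sum_congr rfl fun k _ => ?_
  rw [Finset.sum_mul_sum, ← Finset.sum_sub_distrib]
  refine Finset.sum_congr rfl fun j _ => ?_
  rw [Finset.filter_ne', ← Finset.add_sum_erase _ _ (Finset.mem_univ j)]
  ring

/-- Expansion of `N·P·H(I,J)` as a quadratic form in the entries of the matrix:
a weighted sum of the squared entries and of the double products of unordered
pairs of entries (same row, same column, different rows and columns), with the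
explicit coefficients from the paper's proof of Theorem 1.  Each unordered pair
of distinct entries contributes one double product (here realized by summing
over ordered pairs with `j₁ < j₂`, resp. `i₁ < i₂`). -/
theorem hscore_quadratic_form (N P : ℕ) (hN : 1 ≤ N) (hP : 1 ≤ P)
    (a : Fin N → Fin P → ℝ) :
    (N : ℝ) * (P : ℝ) * Hscore a Finset.univ Finset.univ =
      (((((N : ℝ) * P - N - P + 1) ^ 2 + ((P : ℝ) - 1) * ((N : ℝ) - 1) ^ 2
          + ((P : ℝ) - 1) ^ 2 * ((N : ℝ) - 1) + ((P : ℝ) - 1) * ((N : ℝ) - 1))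
            / ((N : ℝ) ^ 2 * (P : ℝ) ^ 2))
        * ∑ i : Fin N, ∑ j : Fin P, (a i j) ^ 2)
      + (((4 * ((N : ℝ) * P - N - P + 1) * (1 - (N : ℝ))
          + 2 * ((P : ℝ) - 2) * ((N : ℝ) - 1) ^ 2
          + 4 * (1 - (P : ℝ)) * ((N : ℝ) - 1) + 2 * ((P : ℝ) - 2) * ((N : ℝ) - 1))
            / ((N : ℝ) ^ 2 * (P : ℝ) ^ 2))
        * ∑ i : Fin N, ∑ j₁ : Fin P, ∑ j₂ ∈ Finset.filter (fun j₂ => j₁ < j₂) Finset.univ,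
            a i j₁ * a i j₂)
      + (((4 * ((N : ℝ) * P - N - P + 1) * (1 - (P : ℝ))
          + 2 * ((N : ℝ) - 2) * ((P : ℝ) - 1) ^ 2
          + 4 * (1 - (N : ℝ)) * ((P : ℝ) - 1) + 2 * ((N : ℝ) - 2) * ((P : ℝ) - 1))
            / ((N : ℝ) ^ 2 * (P : ℝ) ^ 2))
        * ∑ j : Fin P, ∑ i₁ : Fin N, ∑ i₂ ∈ Finset.filter (fun i₂ => i₁ < i₂) Finset.univ,
            a i₁ j * a i₂ j)
      + (((4 * ((N : ℝ) * P - N - P + 1) + 4 * (1 - (P : ℝ)) * (1 - (N : ℝ))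
          + 4 * ((P : ℝ) - 2) * (1 - (N : ℝ)) + 4 * (1 - (P : ℝ)) * ((N : ℝ) - 2)
          + 2 * ((P : ℝ) - 2) * ((N : ℝ) - 2))
            / ((N : ℝ) ^ 2 * (P : ℝ) ^ 2))
        * ∑ i₁ : Fin N, ∑ i₂ ∈ Finset.filter (fun i₂ => i₁ < i₂) Finset.univ,
            ∑ j₁ : Fin P, ∑ j₂ ∈ Finset.filter (fun j₂ => j₂ ≠ j₁) Finset.univ,
              a i₁ j₁ * a i₂ j₂) := by
  have hn : (N : ℝ) ≠ 0 := by positivity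
  have hp : (P : ℝ) ≠ 0 := by positivity
  rw [sum_mix]
  simp only [two_mul_sum_lt (fun j => a _ j), two_mul_sum_lt (fun i => a i _)]
  unfold Hscore
  simp only [Finset.card_univ, Fintype.card_fin]
  rw [sum_residue]
  simp only [← Finset.sum_div, Finset.sum_sub_distrib]
  rw [Finset.sum_comm (f := fun j i => a i j ^ 2)]
  field_simp
  ring
end

section
/- Let a = (a_{ij}) be a real matrix indexed by I = {1,…,N} and J = {1,…,P} with P ≥ 1, and let 2 ≤ n ≤ N. Let H̄_n = C(N,n)^{-1} Σ_{S ⊆ I, |S| = n} H(S,J) be the average H-score of all n-row submatrices. Then H̄_n = [(P−1)(n−1)/(N n P²)] · Σ_{i,j} a_{ij}² + [2(1−n)/(N n P²)] · Σ (double products of pairs of entries in the same row, distinct columns) + [2(1−P)(n−1)/(N n P² (N−1))] · Σ (double products of pairs of entries in the same column, distinct rows) + [2(n−1)/(N n P² (N−1))] · Σ (double products of pairs of entries in different rows and different columns), where each unordered pair of distinct entries contributes one double product. -/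
open Finset

lemma sum_lt_aux (N : ℕ) (F : Fin N → Fin N → ℝ) (hF : ∀ i k, F i k = F k i) :
    ∑ i, ∑ k ∈ Finset.filter (fun k => i < k) Finset.univ, F i k
      = (∑ i, ∑ k, F i k - ∑ i, F i i) / 2 := by
  have h1 : ∀ i k : Fin N, F i k = (if i < k then F i k else 0) + (if k < i then F k i else 0)
      + (if i = k then F i i else 0) := by
    intro i k
    rcases lt_trichotomy i k with h | h | h
    · simp [h, h.not_gt, h.ne]
    · subst h; simp
    · simp [h, h.not_gt, h.ne', hF i k]
  have h2 : ∑ i, ∑ k, F i k = ∑ i, ∑ k, (if i < k then F i k else 0)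
      + ∑ i, ∑ k, (if i < k then F i k else 0) + ∑ i, F i i := by
    have e : ∑ i, ∑ k, F i k = ∑ i, ∑ k, ((if i < k then F i k else 0)
      + (if k < i then F k i else 0) + (if i = k then F i i else 0)) :=
      Finset.sum_congr rfl fun i _ => Finset.sum_congr rfl fun k _ => h1 i k
    rw [e]
    simp only [Finset.sum_add_distrib]
    congr 1
    · congr 1
      rw [Finset.sum_comm]
    · simp
  simp only [Finset.sum_filter]
  linarith

lemma count_aux (N n : ℕ) (T : Finset (Fin N)) (hT : T.card ≤ n) :
    ((Finset.powersetCard n (Finset.univ : Finset (Fin N))).filter (fun S => T ⊆ S)).card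
      = (N - T.card).choose (n - T.card) := by
  have : (N - T.card).choose (n - T.card)
      = (Finset.powersetCard (n - T.card) (Finset.univ \ T)).card := by
    rw [Finset.card_powersetCard, Finset.card_sdiff_of_subset (Finset.subset_univ _)]
    simp
  rw [this]
  refine Finset.card_bij' (fun S _ => S \ T) (fun U _ => U ∪ T) ?_ ?_ ?_ ?_
  · intro S hS
    simp only [Finset.mem_filter, Finset.mem_powersetCard] at hS ⊢
    exact ⟨Finset.sdiff_subset_sdiff hS.1.1 (Finset.Subset.refl _), by
      rw [Finset.card_sdiff_of_subset hS.2, hS.1.2]⟩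
  · intro U hU
    simp only [Finset.mem_filter, Finset.mem_powersetCard] at hU ⊢
    have hd : Disjoint U T := Finset.disjoint_of_subset_left hU.1 Finset.sdiff_disjoint
    refine ⟨⟨Finset.subset_univ _, ?_⟩, Finset.subset_union_right⟩
    rw [Finset.card_union_of_disjoint hd, hU.2]; omega
  · intro S hS
    simp only [Finset.mem_filter] at hS
    exact Finset.sdiff_union_of_subset hS.2
  · intro U hU
    simp only [Finset.mem_powersetCard] at hU
    have hd : Disjoint U T := Finset.disjoint_of_subset_left hU.1 Finset.sdiff_disjoint
    exact Finset.union_sdiff_cancel_right hd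

lemma sum_single_aux (N n : ℕ) (hn : 1 ≤ n) (f : Fin N → ℝ) :
    ∑ S ∈ Finset.powersetCard n (Finset.univ : Finset (Fin N)), ∑ i ∈ S, f i
      = ((N - 1).choose (n - 1) : ℝ) * ∑ i, f i := by
  have e : ∀ S : Finset (Fin N), ∑ i ∈ S, f i = ∑ i, if {i} ⊆ S then f i else 0 := by
    intro S; simp
  simp only [e]
  rw [Finset.sum_comm, Finset.mul_sum]
  refine Finset.sum_congr rfl fun i _ => ?_
  rw [← Finset.sum_filter, Finset.sum_const, count_aux N n {i} (by simpa using hn)]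
  simp

lemma sum_pair_aux (N n : ℕ) (hn : 2 ≤ n) (F : Fin N → Fin N → ℝ) :
    ∑ S ∈ Finset.powersetCard n (Finset.univ : Finset (Fin N)), ∑ i ∈ S, ∑ k ∈ S, F i k
      = ((N - 1).choose (n - 1) : ℝ) * ∑ i, F i i
        + ((N - 2).choose (n - 2) : ℝ) * (∑ i, ∑ k, F i k - ∑ i, F i i) := by
  have e : ∀ S : Finset (Fin N), ∑ i ∈ S, ∑ k ∈ S, F i k
      = ∑ i, ∑ k, if {i, k} ⊆ S then F i k else 0 := by
    intro S
    simp only [Finset.insert_subset_iff, Finset.singleton_subset_iff, ite_and]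
    have h1 : ∀ i, (∑ k, if i ∈ S then (if k ∈ S then F i k else 0) else 0)
        = if i ∈ S then ∑ k ∈ S, F i k else 0 := by
      intro i
      by_cases h : i ∈ S <;> simp [h]
    simp only [h1]
    simp
  rw [Finset.sum_congr rfl fun S _ => e S]
  rw [Finset.sum_comm]
  have e2 : ∀ i, ∑ S ∈ Finset.powersetCard n (Finset.univ : Finset (Fin N)),
      ∑ k, (if {i, k} ⊆ S then F i k else 0)
      = ∑ k, (((N - 2).choose (n - 2) : ℝ) * F i k
        + if i = k then (((N - 1).choose (n - 1) : ℝ) - ((N - 2).choose (n - 2) : ℝ)) * F i i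
          else 0) := by
    intro i
    rw [Finset.sum_comm]
    refine Finset.sum_congr rfl fun k _ => ?_
    rw [← Finset.sum_filter, Finset.sum_const, count_aux N n {i, k} (Finset.card_le_two.trans hn)]
    by_cases h : i = k
    · subst h; simp; ring
    · simp [Finset.card_pair h, h]
  simp only [e2, Finset.sum_add_distrib, ← Finset.mul_sum]
  simp only [Finset.sum_ite_eq, Finset.mem_univ, if_true, ← Finset.mul_sum]
  ring

lemma Hscore_aux {N P : ℕ} (hP : 1 ≤ P) (a : Fin N → Fin P → ℝ) (S : Finset (Fin N))
    (hS : S.card ≠ 0) :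
    Hscore a S Finset.univ = (1 / ((S.card : ℝ) * P)) *
      (∑ i ∈ S, ∑ j, a i j ^ 2 - (1 / (P : ℝ)) * ∑ i ∈ S, (∑ j, a i j) ^ 2
        - (1 / (S.card : ℝ)) * ∑ i ∈ S, ∑ k ∈ S, ∑ j, a i j * a k j
        + (1 / ((S.card : ℝ) * P)) * ∑ i ∈ S, ∑ k ∈ S, (∑ j, a i j) * (∑ j, a k j)) := by
  have hp : (P : ℝ) ≠ 0 := by positivity
  have hs : (S.card : ℝ) ≠ 0 := by exact_mod_cast hS
  have hC : ∑ i ∈ S, ∑ k ∈ S, ∑ j, a i j * a k j = ∑ j, (∑ i ∈ S, a i j) ^ 2 := by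
    simp only [sq, Finset.sum_mul_sum]
    rw [Finset.sum_comm]
    rw [Finset.sum_comm (s := Finset.univ)]
    refine Finset.sum_congr rfl fun i _ => ?_
    rw [Finset.sum_comm]
    simp only [mul_comm]
  have hG : ∑ i ∈ S, ∑ k ∈ S, (∑ j, a i j) * (∑ j, a k j) = (∑ i ∈ S, ∑ j, a i j) ^ 2 := by
    simp only [sq, Finset.sum_mul_sum]
  rw [hC, hG]
  unfold Hscore
  simp only [Finset.card_univ, Fintype.card_fin]
  congr 1
  have hg : ∑ j, ∑ i ∈ S, a i j = ∑ i ∈ S, ∑ j, a i j := Finset.sum_comm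
  set g := ∑ i ∈ S, ∑ j, a i j with hgdef
  generalize hr : (fun i => ∑ j, a i j) = r
  generalize hc : (fun j => ∑ i ∈ S, a i j) = c
  have hr' : ∀ i, ∑ j, a i j = r i := fun i => congrFun hr i
  have hc' : ∀ j, ∑ i ∈ S, a i j = c j := fun i => congrFun hc i
  simp only [hr', hc'] at hg hgdef ⊢
  have key : ∀ i j, (a i j - 1 / (P : ℝ) * r i - 1 / (S.card : ℝ) * c j
      + 1 / ((S.card : ℝ) * P) * g) ^ 2
      = a i j ^ 2 + (1 / (P : ℝ)) ^ 2 * r i ^ 2 + (1 / (S.card : ℝ)) ^ 2 * c j ^ 2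
        + (1 / ((S.card : ℝ) * P) * g) ^ 2
        - (2 * (1 / (P : ℝ))) * (r i * a i j) - 2 * (1 / (S.card : ℝ)) * (c j * a i j)
        + (2 * (1 / ((S.card : ℝ) * P) * g)) * a i j
        + (2 * (1 / (P : ℝ)) * (1 / (S.card : ℝ))) * (r i * c j)
        - (2 * (1 / (P : ℝ)) * (1 / ((S.card : ℝ) * P) * g)) * r i
        - (2 * (1 / (S.card : ℝ)) * (1 / ((S.card : ℝ) * P) * g)) * c j := by
    intro i j; ring
  simp only [key, Finset.sum_add_distrib, Finset.sum_sub_distrib, ← Finset.mul_sum,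
    Finset.sum_const, Finset.card_univ, Fintype.card_fin, nsmul_eq_mul, hr', hg]
  have h1 : ∑ i ∈ S, ∑ j, c j * a i j = ∑ j, c j ^ 2 := by
    rw [Finset.sum_comm]
    refine Finset.sum_congr rfl fun j _ => ?_
    rw [← Finset.mul_sum, hc', sq]
  have h2 : ∑ i ∈ S, r i * r i = ∑ i ∈ S, r i ^ 2 := by simp only [sq]
  simp only [hr', h1, h2, ← Finset.sum_mul, ← hgdef]
  field_simp
  ring

/-- The average H-score `H̄_n` is a quadratic form in the entries of the full
matrix, with the four explicit averaged coefficients from the paper's proof of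
Theorem 1 (squared entries; double products of pairs in the same row; of pairs
in the same column; of pairs in different rows and columns).  Each unordered
pair of distinct entries contributes one double product (here realized by
summing over ordered pairs with `j₁ < j₂`, resp. `i₁ < i₂`). -/
theorem hbar_row_quadratic_form (N P : ℕ) (hP : 1 ≤ P)
    (n : ℕ) (hn : 2 ≤ n) (hnN : n ≤ N) (a : Fin N → Fin P → ℝ) :
    HbarRow N P a n =
      ((((P : ℝ) - 1) * ((n : ℝ) - 1) / ((N : ℝ) * (n : ℝ) * (P : ℝ) ^ 2))
        * ∑ i : Fin N, ∑ j : Fin P, (a i j) ^ 2)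
      + ((2 * (1 - (n : ℝ)) / ((N : ℝ) * (n : ℝ) * (P : ℝ) ^ 2))
        * ∑ i : Fin N, ∑ j₁ : Fin P, ∑ j₂ ∈ Finset.filter (fun j₂ => j₁ < j₂) Finset.univ,
            a i j₁ * a i j₂)
      + ((2 * (1 - (P : ℝ)) * ((n : ℝ) - 1)
            / ((N : ℝ) * (n : ℝ) * (P : ℝ) ^ 2 * ((N : ℝ) - 1)))
        * ∑ j : Fin P, ∑ i₁ : Fin N, ∑ i₂ ∈ Finset.filter (fun i₂ => i₁ < i₂) Finset.univ,
            a i₁ j * a i₂ j)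
      + ((2 * ((n : ℝ) - 1) / ((N : ℝ) * (n : ℝ) * (P : ℝ) ^ 2 * ((N : ℝ) - 1)))
        * ∑ i₁ : Fin N, ∑ i₂ ∈ Finset.filter (fun i₂ => i₁ < i₂) Finset.univ,
            ∑ j₁ : Fin P, ∑ j₂ ∈ Finset.filter (fun j₂ => j₂ ≠ j₁) Finset.univ,
              a i₁ j₁ * a i₂ j₂) := by
  have hN2 : 2 ≤ N := hn.trans hnN
  have hp : (P : ℝ) ≠ 0 := by positivity
  have hn0 : (n : ℝ) ≠ 0 := by positivity
  have hN0 : (N : ℝ) ≠ 0 := by positivity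
  have hN1 : (N : ℝ) - 1 ≠ 0 := by
    have : (2 : ℝ) ≤ N := by exact_mod_cast hN2
    intro h; linarith
  have hch : (N.choose n : ℝ) ≠ 0 := by
    exact_mod_cast (Nat.choose_pos hnN).ne'
  have hA : ((N - 1).choose (n - 1) : ℝ) = n / N * N.choose n := by
    obtain ⟨m, rfl⟩ : ∃ m, n = m + 1 := ⟨n - 1, by omega⟩
    obtain ⟨M, rfl⟩ : ∃ M, N = M + 1 := ⟨N - 1, by omega⟩
    have := Nat.add_one_mul_choose_eq M m
    have h : ((M : ℝ) + 1) * M.choose m = (M + 1).choose (m + 1) * (m + 1) := by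
      exact_mod_cast this
    simp only [Nat.add_sub_cancel]
    push_cast at hN0 ⊢
    field_simp
    linarith
  have hB : ((N - 2).choose (n - 2) : ℝ) = (n - 1) / (N - 1) * ((N - 1).choose (n - 1) : ℝ) := by
    obtain ⟨m, rfl⟩ : ∃ m, n = m + 2 := ⟨n - 2, by omega⟩
    obtain ⟨M, rfl⟩ : ∃ M, N = M + 2 := ⟨N - 2, by omega⟩
    have := Nat.add_one_mul_choose_eq M m
    have h : ((M : ℝ) + 1) * M.choose m = (M + 1).choose (m + 1) * (m + 1) := by
      exact_mod_cast this
    have e1 : M + 2 - 1 = M + 1 := by omega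
    have e2 : m + 2 - 1 = m + 1 := by omega
    rw [e1, e2]
    simp only [Nat.add_sub_cancel]
    push_cast at hN1 ⊢
    field_simp
    linarith
  rw [hA] at hB
  have hH : HbarRow N P a n = ((N.choose n : ℝ))⁻¹ * ((1 / ((n : ℝ) * P)) *
      (∑ S ∈ Finset.powersetCard n (Finset.univ : Finset (Fin N)), ∑ i ∈ S, ∑ j, a i j ^ 2
        - (1 / (P : ℝ)) * ∑ S ∈ Finset.powersetCard n (Finset.univ : Finset (Fin N)),
            ∑ i ∈ S, (∑ j, a i j) ^ 2
        - (1 / (n : ℝ)) * ∑ S ∈ Finset.powersetCard n (Finset.univ : Finset (Fin N)),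
            ∑ i ∈ S, ∑ k ∈ S, ∑ j, a i j * a k j
        + (1 / ((n : ℝ) * P)) * ∑ S ∈ Finset.powersetCard n (Finset.univ : Finset (Fin N)),
            ∑ i ∈ S, ∑ k ∈ S, (∑ j, a i j) * (∑ j, a k j))) := by
    unfold HbarRow
    congr 1
    simp only [Finset.mul_sum (Finset.powersetCard n (Finset.univ : Finset (Fin N))),
      ← Finset.sum_sub_distrib, ← Finset.sum_add_distrib]
    refine Finset.sum_congr rfl fun S hS => ?_
    have hc := (Finset.mem_powersetCard.mp hS).2
    rw [Hscore_aux hP a S (by omega), hc]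
  rw [hH, sum_single_aux N n (by omega), sum_single_aux N n (by omega),
    sum_pair_aux N n hn, sum_pair_aux N n hn, hA, hB]
  have r1 : ∑ i : Fin N, ∑ j₁ : Fin P, ∑ j₂ ∈ Finset.filter (fun j₂ => j₁ < j₂) Finset.univ,
            a i j₁ * a i j₂ = (∑ i, (∑ j, a i j) ^ 2 - ∑ i, ∑ j, a i j ^ 2) / 2 := by
    rw [← Finset.sum_sub_distrib, Finset.sum_div]
    refine Finset.sum_congr rfl fun i _ => ?_
    rw [sum_lt_aux P (fun j k => a i j * a i k) (fun j k => mul_comm _ _)]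
    simp only [sq, Finset.sum_mul_sum]
  have r2 : ∑ j : Fin P, ∑ i₁ : Fin N, ∑ i₂ ∈ Finset.filter (fun i₂ => i₁ < i₂) Finset.univ,
            a i₁ j * a i₂ j = (∑ i, ∑ k, ∑ j, a i j * a k j - ∑ i, ∑ j, a i j ^ 2) / 2 := by
    have := sum_lt_aux N (fun i k => ∑ j, a i j * a k j)
      (fun i k => Finset.sum_congr rfl fun j _ => mul_comm _ _)
    simp only [← sq] at this
    rw [← this, Finset.sum_comm]
    refine Finset.sum_congr rfl fun i _ => ?_
    rw [Finset.sum_comm]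
  have r3 : ∑ i₁ : Fin N, ∑ i₂ ∈ Finset.filter (fun i₂ => i₁ < i₂) Finset.univ,
            ∑ j₁ : Fin P, ∑ j₂ ∈ Finset.filter (fun j₂ => j₂ ≠ j₁) Finset.univ,
              a i₁ j₁ * a i₂ j₂
      = ((∑ i, ∑ k, (∑ j, a i j) * (∑ j, a k j) - ∑ i, ∑ k, ∑ j, a i j * a k j)
        - (∑ i, (∑ j, a i j) ^ 2 - ∑ i, ∑ j, a i j ^ 2)) / 2 := by
    have e : ∀ i k, ∑ j₁ : Fin P, ∑ j₂ ∈ Finset.filter (fun j₂ => j₂ ≠ j₁) Finset.univ,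
              a i j₁ * a k j₂ = (∑ j, a i j) * (∑ j, a k j) - ∑ j, a i j * a k j := by
      intro i k
      rw [Finset.sum_mul_sum, ← Finset.sum_sub_distrib]
      refine Finset.sum_congr rfl fun j _ => ?_
      rw [Finset.filter_ne', eq_sub_iff_add_eq, Finset.sum_erase_add _ _ (Finset.mem_univ j)]
    simp only [e]
    rw [sum_lt_aux N (fun i k => (∑ j, a i j) * (∑ j, a k j) - ∑ j, a i j * a k j)
      (fun i k => by simp only [mul_comm])]
    simp only [Finset.sum_sub_distrib, sq]
  rw [r1, r2, r3]
  simp only [← sq]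
  generalize ∑ i, ∑ j, a i j ^ 2 = Q
  generalize ∑ i, (∑ j, a i j) ^ 2 = R
  generalize ∑ i, ∑ k, ∑ j, a i j * a k j = C
  generalize ∑ i, ∑ k, (∑ j, a i j) * (∑ j, a k j) = G
  field_simp
  ring
end
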